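/- (Comparability of norms for positive solutions with nonnegative nonlinearity.) Let Ω ⊆ ℝⁿ (n ≥ 2) be a bounded smooth domain. Then there exists a constant C ≥ 1 depending only on Ω such that for every continuous function f : ℝ → ℝ with f ≥ 0 on [0,∞) and every classical solution u of −Δu = f(u) in Ω with u = 0 on ∂Ω and u > 0 in Ω, the three quantities ‖u‖_{L¹(Ω)} = ∫_Ω u dx, ‖u‖_{L¹_δ(Ω)} = ∫_Ω u(x)·dist(x,∂Ω) dx, and ‖f(u)‖_{L¹_δ(Ω)} = ∫_Ω f(u(x))·dist(x,∂Ω) dx are mutually comparable: each is at most C times each of the others. -/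

import Mathlib

open MeasureTheory Filter

noncomputable section

/-- The Euclidean Laplacian: trace of the Hessian. -/
def lapl {n : ℕ} (u : EuclideanSpace ℝ (Fin n) → ℝ) (x : EuclideanSpace ℝ (Fin n)) : ℝ :=
  ∑ i : Fin n, fderiv ℝ (fun y => fderiv ℝ u y (EuclideanSpace.single i 1)) x
    (EuclideanSpace.single i 1)

/-- Entries of the Hessian matrix. -/
def hess {n : ℕ} (u : EuclideanSpace ℝ (Fin n) → ℝ) (x : EuclideanSpace ℝ (Fin n))
    (i j : Fin n) : ℝ :=
  fderiv ℝ (fun y => fderiv ℝ u y (EuclideanSpace.single j 1)) x (EuclideanSpace.single i 1)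

/-- A bounded smooth domain of ℝⁿ. -/
def IsSmoothBoundedDomain {n : ℕ} (Ω : Set (EuclideanSpace ℝ (Fin n))) : Prop :=
  IsOpen Ω ∧ Bornology.IsBounded Ω ∧ Ω.Nonempty ∧
  ∃ ρ : EuclideanSpace ℝ (Fin n) → ℝ, ContDiff ℝ (⊤ : ℕ∞) ρ ∧
    Ω = {x | ρ x < 0} ∧ frontier Ω = {x | ρ x = 0} ∧
    ∀ x ∈ frontier Ω, gradient ρ x ≠ 0

/-- Classical solution of −Δu = f(u) in Ω, u = 0 on ∂Ω. -/
def IsClassicalSol {n : ℕ} (Ω : Set (EuclideanSpace ℝ (Fin n))) (f : ℝ → ℝ)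
    (u : EuclideanSpace ℝ (Fin n) → ℝ) : Prop :=
  (∃ U, IsOpen U ∧ closure Ω ⊆ U ∧ ContDiffOn ℝ 2 u U) ∧
  (∀ x ∈ Ω, lapl u x + f (u x) = 0) ∧
  (∀ x ∈ frontier Ω, u x = 0)

/-- Semi-stability of a solution u. -/
def IsSemiStable {n : ℕ} (Ω : Set (EuclideanSpace ℝ (Fin n))) (f : ℝ → ℝ)
    (u : EuclideanSpace ℝ (Fin n) → ℝ) : Prop :=
  ∀ ξ : EuclideanSpace ℝ (Fin n) → ℝ, (∃ K : NNReal, LipschitzWith K ξ) →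
    (∀ x ∈ frontier Ω, ξ x = 0) →
    0 ≤ ∫ x in Ω, (‖gradient ξ x‖ ^ 2 - deriv f (u x) * ξ x ^ 2)

/-- Weak solution of −Δu = f(u) in Ω, u = 0 on ∂Ω. -/
def IsWeakSol {n : ℕ} (Ω : Set (EuclideanSpace ℝ (Fin n))) (f : ℝ → ℝ)
    (u : EuclideanSpace ℝ (Fin n) → ℝ) : Prop :=
  IntegrableOn u Ω volume ∧
  IntegrableOn (fun x => f (u x) * Metric.infDist x (frontier Ω)) Ω volume ∧
  ∀ ξ : EuclideanSpace ℝ (Fin n) → ℝ,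
    (∃ U, IsOpen U ∧ closure Ω ⊆ U ∧ ContDiffOn ℝ 2 ξ U) →
    (∀ x ∈ frontier Ω, ξ x = 0) →
    ∫ x in Ω, (u x * lapl ξ x + f (u x) * ξ x) = 0

open scoped Topology

theorem integrableOn_of_continuousOn_closure {E : Type*} [NormedAddCommGroup E]
    [NormedSpace ℝ E] [FiniteDimensional ℝ E] [MeasurableSpace E] [BorelSpace E]
    {μ : Measure E} [IsFiniteMeasureOnCompacts μ] {Ω : Set E}
    (hb : Bornology.IsBounded Ω) {g : E → ℝ} (hg : ContinuousOn g (closure Ω)) :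
    IntegrableOn g Ω μ :=
  (hg.integrableOn_compact hb.isCompact_closure).mono_set subset_closure

/-- A `C¹` approximation of the identity on `[0, ∞)` vanishing on `(-∞, ε]`. -/
def flatten (ε t : ℝ) : ℝ := max t ε - 2 * ε + ε ^ 2 / max t ε

/-- The derivative of `flatten ε`. -/
def flattenDeriv (ε t : ℝ) : ℝ := 1 - ε ^ 2 / max t ε ^ 2

theorem flatten_of_le {ε t : ℝ} (hε : 0 < ε) (h : t ≤ ε) : flatten ε t = 0 := by
  rw [flatten, max_eq_right h]
  have := hε.ne'
  field_simp
  ring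

theorem abs_flatten_le {ε t : ℝ} (hε : 0 < ε) (ht : 0 ≤ t) : |flatten ε t| ≤ |t| := by
  rcases le_total t ε with h | h
  · rw [flatten_of_le hε h, abs_zero]
    exact abs_nonneg t
  · have h' : 0 < t := hε.trans_le h
    have : flatten ε t = (t - ε) * ((t - ε) / t) := by
      rw [flatten, max_eq_left h]
      field_simp
      ring
    have h1 : (t - ε) / t ≤ 1 := (div_le_one h').2 (by linarith)
    have h2 : 0 ≤ (t - ε) / t := div_nonneg (by linarith) h'.le
    rw [this, abs_of_nonneg (mul_nonneg (by linarith) h2), abs_of_pos h']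
    nlinarith

theorem abs_flattenDeriv_le_one {ε : ℝ} (hε : 0 < ε) (t : ℝ) : |flattenDeriv ε t| ≤ 1 := by
  have hm : ε ≤ max t ε := le_max_right _ _
  have h1 : ε ^ 2 / max t ε ^ 2 ≤ 1 :=
    (div_le_one (pow_pos (hε.trans_le hm) 2)).2 (pow_le_pow_left₀ hε.le hm 2)
  have h2 : 0 ≤ ε ^ 2 / max t ε ^ 2 := by positivity
  rw [flattenDeriv, abs_of_nonneg] <;> linarith

theorem continuous_flattenDeriv {ε : ℝ} (hε : 0 < ε) : Continuous (flattenDeriv ε) := by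
  have hm : ∀ t, max t ε ^ 2 ≠ 0 := fun t => (pow_pos (hε.trans_le (le_max_right t ε)) 2).ne'
  unfold flattenDeriv
  fun_prop (disch := exact hm _)

theorem continuous_flatten {ε : ℝ} (hε : 0 < ε) : Continuous (flatten ε) := by
  have hm : ∀ t, max t ε ≠ 0 := fun t => (hε.trans_le (le_max_right t ε)).ne'
  unfold flatten
  fun_prop (disch := exact hm _)

theorem hasDerivAt_flatten {ε : ℝ} (hε : 0 < ε) (t : ℝ) :
    HasDerivAt (flatten ε) (flattenDeriv ε t) t := by
  have hne : ∀ s ≠ ε, HasDerivAt (flatten ε) (flattenDeriv ε s) s := by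
    intro s hs
    rcases lt_or_gt_of_ne hs with h | h
    · have h1 : flattenDeriv ε s = 0 := by
        rw [flattenDeriv, max_eq_right h.le, div_self (by positivity), sub_self]
      rw [h1]
      refine (hasDerivAt_const s (0 : ℝ)).congr_of_eventuallyEq ?_
      filter_upwards [Iio_mem_nhds h] with r hr using flatten_of_le hε (le_of_lt hr)
    · have hs0 : s ≠ 0 := (hε.trans h).ne'
      have h1 : HasDerivAt (fun r => r - 2 * ε + ε ^ 2 / r) (flattenDeriv ε s) s := by
        refine (((hasDerivAt_id s).sub_const (2 * ε)).add
          ((hasDerivAt_inv hs0).const_mul (ε ^ 2))).congr_deriv ?_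
        rw [flattenDeriv, max_eq_left h.le]
        ring
      refine h1.congr_of_eventuallyEq ?_
      filter_upwards [Ioi_mem_nhds h] with r hr
      rw [flatten, max_eq_left (le_of_lt hr)]
  rcases eq_or_ne t ε with rfl | h
  · exact hasDerivAt_of_hasDerivAt_of_ne hne (continuous_flatten hε).continuousAt
      (continuous_flattenDeriv hε).continuousAt
  · exact hne t h

theorem contDiff_flatten {ε : ℝ} (hε : 0 < ε) : ContDiff ℝ 1 (flatten ε) := by
  rw [contDiff_one_iff_deriv]
  refine ⟨fun t => (hasDerivAt_flatten hε t).differentiableAt, ?_⟩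
  rw [funext fun t => (hasDerivAt_flatten hε t).deriv]
  exact continuous_flattenDeriv hε

theorem tendsto_flatten {t : ℝ} (ht : 0 < t) :
    Tendsto (fun ε => flatten ε t) (𝓝 0) (𝓝 t) := by
  have : ContinuousAt (fun ε => flatten ε t) 0 := by
    unfold flatten
    have : max t 0 ≠ 0 := by rw [max_eq_left ht.le]; exact ht.ne'
    fun_prop (disch := exact this)
  simpa [ContinuousAt, flatten, max_eq_left ht.le] using this

theorem tendsto_flattenDeriv {t : ℝ} (ht : 0 < t) :
    Tendsto (fun ε => flattenDeriv ε t) (𝓝 0) (𝓝 1) := by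
  have : ContinuousAt (fun ε => flattenDeriv ε t) 0 := by
    unfold flattenDeriv
    have : max t 0 ^ 2 ≠ 0 := by rw [max_eq_left ht.le]; positivity
    fun_prop (disch := exact this)
  simpa [ContinuousAt, flattenDeriv] using this

section GreenIdentity

variable {E : Type*} [NormedAddCommGroup E] [NormedSpace ℝ E] [FiniteDimensional ℝ E]
  [MeasurableSpace E] [BorelSpace E] {μ : Measure E} [μ.IsAddHaarMeasure]

/-- The integral of a directional derivative of a compactly supported `C¹` function vanishes. -/
theorem integral_fderiv_apply_eq_zero {g : E → ℝ} (hg : ContDiff ℝ 1 g)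
    (hc : HasCompactSupport g) (e : E) : ∫ x, fderiv ℝ g x e ∂μ = 0 := by
  have hd : Continuous fun x => fderiv ℝ g x e :=
    (hg.continuous_fderiv one_ne_zero).clm_apply continuous_const
  have hcd : HasCompactSupport fun x => fderiv ℝ g x e := hc.fderiv_apply ℝ e
  have h := integral_mul_fderiv_eq_neg_fderiv_mul_of_integrable (μ := μ) (f := fun _ : E => (1 : ℝ))
    (g := g) (v := e) (by simp) (by simpa using hd.integrable_of_hasCompactSupport hcd)
    (by simpa using hg.continuous.integrable_of_hasCompactSupport hc)
    (fun x _ => differentiableAt_const _) (fun x _ => hg.differentiable one_ne_zero x)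
  simpa using h

variable {Ω U : Set E} {v h : E → ℝ}

theorem integral_flatten_mul_eq_zero (hΩ : IsOpen Ω) (hb : Bornology.IsBounded Ω)
    (hU : IsOpen U) (hΩU : closure Ω ⊆ U) (hv : ContDiffOn ℝ 1 v U) (hh : ContDiffOn ℝ 1 h U)
    (h0 : ∀ x ∈ frontier Ω, v x = 0) (e : E) {ε : ℝ} (hε : 0 < ε) :
    ∫ x in Ω, (flattenDeriv ε (v x) * fderiv ℝ v x e * h x
      + flatten ε (v x) * fderiv ℝ h x e) ∂μ = 0 := by
  set ψ : E → ℝ := Ω.indicator fun x => flatten ε (v x) * h x with hψ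
  set K : Set E := closure Ω ∩ v ⁻¹' Set.Ici ε with hK
  have hKcomp : IsCompact K :=
    hb.isCompact_closure.of_isClosed_subset
      ((hv.continuousOn.mono hΩU).preimage_isClosed_of_isClosed isClosed_closure isClosed_Ici)
      Set.inter_subset_left
  have hKΩ : K ⊆ Ω := by
    rintro x ⟨hx, hvx⟩
    by_contra hxΩ
    have := h0 x ⟨hx, by rwa [hΩ.interior_eq]⟩
    simp only [Set.mem_preimage, Set.mem_Ici, this] at hvx
    linarith
  have hψK : ∀ x ∉ K, ψ x = 0 := by
    intro x hx
    rw [hψ, Set.indicator_apply_eq_zero]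
    intro hxΩ
    have : v x < ε := by
      by_contra hc
      exact hx ⟨subset_closure hxΩ, not_lt.1 hc⟩
    rw [flatten_of_le hε this.le, zero_mul]
  have hdiff : ∀ {w : E → ℝ}, ContDiffOn ℝ 1 w U → ∀ x ∈ Ω, ContDiffAt ℝ 1 w x :=
    fun hw x hx => hw.contDiffAt (hU.mem_nhds (hΩU (subset_closure hx)))
  have hψΩ : ∀ x ∈ Ω, ψ =ᶠ[𝓝 x] fun x => flatten ε (v x) * h x := fun x hx => by
    filter_upwards [hΩ.mem_nhds hx] with y hy using Set.indicator_of_mem hy _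
  have hψ0 : ∀ x ∉ K, ψ =ᶠ[𝓝 x] fun _ => 0 := fun x hx => by
    filter_upwards [hKcomp.isClosed.isOpen_compl.mem_nhds hx] with y hy using hψK y hy
  have hcd : ContDiff ℝ 1 ψ := by
    rw [contDiff_iff_contDiffAt]
    intro x
    by_cases hx : x ∈ K
    · have hxΩ := hKΩ hx
      exact (((contDiff_flatten hε).contDiffAt.comp x (hdiff hv x hxΩ)).mul
        (hdiff hh x hxΩ)).congr_of_eventuallyEq (hψΩ x hxΩ)
    · exact contDiffAt_const.congr_of_eventuallyEq (hψ0 x hx)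
  have hcs : HasCompactSupport ψ := HasCompactSupport.intro hKcomp hψK
  have hint := integral_fderiv_apply_eq_zero (μ := μ) hcd hcs e
  rw [← setIntegral_eq_integral_of_forall_compl_eq_zero (s := Ω)] at hint
  · rw [← hint]
    refine setIntegral_congr_fun hΩ.measurableSet fun x hx => ?_
    have h1 : HasFDerivAt (fun x => flatten ε (v x)) (flattenDeriv ε (v x) • fderiv ℝ v x) x :=
      (hasDerivAt_flatten hε (v x)).comp_hasFDerivAt x
        ((hdiff hv x hx).differentiableAt one_ne_zero).hasFDerivAt
    have h2 := ((hdiff hh x hx).differentiableAt one_ne_zero).hasFDerivAt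
    rw [((h1.mul h2).congr_of_eventuallyEq (hψΩ x hx)).fderiv]
    simp only [add_apply, smul_apply, smul_eq_mul]
    ring
  · intro x hx
    rw [(hψ0 x fun hxK => hx (hKΩ hxK)).fderiv_eq]
    simp

theorem integral_fderiv_mul_add_eq_zero (hΩ : IsOpen Ω) (hb : Bornology.IsBounded Ω)
    (hU : IsOpen U) (hΩU : closure Ω ⊆ U) (hv : ContDiffOn ℝ 1 v U) (hh : ContDiffOn ℝ 1 h U)
    (hpos : ∀ x ∈ Ω, 0 < v x) (h0 : ∀ x ∈ frontier Ω, v x = 0) (e : E) :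
    ∫ x in Ω, (fderiv ℝ v x e * h x + v x * fderiv ℝ h x e) ∂μ = 0 := by
  have hcv : ContinuousOn v (closure Ω) := hv.continuousOn.mono hΩU
  have hch : ContinuousOn h (closure Ω) := hh.continuousOn.mono hΩU
  have hfd : ∀ {w : E → ℝ}, ContDiffOn ℝ 1 w U →
      ContinuousOn (fun x => fderiv ℝ w x e) (closure Ω) := fun hw =>
    (((hw.continuousOn_fderiv_of_isOpen hU le_rfl).mono hΩU).clm_apply continuousOn_const)
  have hcv' := hfd hv
  have hch' := hfd hh
  set ε : ℕ → ℝ := fun k => 1 / ((k : ℝ) + 1)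
  have hε : ∀ k, 0 < ε k := fun k => by positivity
  have hε0 : Tendsto ε atTop (𝓝 0) := tendsto_one_div_add_atTop_nhds_zero_nat
  have hlim := tendsto_integral_of_dominated_convergence (μ := μ.restrict Ω)
    (F := fun k x => flattenDeriv (ε k) (v x) * fderiv ℝ v x e * h x
      + flatten (ε k) (v x) * fderiv ℝ h x e)
    (f := fun x => fderiv ℝ v x e * h x + v x * fderiv ℝ h x e)
    (fun x => |fderiv ℝ v x e| * |h x| + |v x| * |fderiv ℝ h x e|) ?_ ?_ ?_ ?_
  · simp only [integral_flatten_mul_eq_zero hΩ hb hU hΩU hv hh h0 e (hε _)] at hlim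
    exact (tendsto_nhds_unique hlim tendsto_const_nhds)
  · intro k
    refine (integrableOn_of_continuousOn_closure hb ?_).aestronglyMeasurable
    exact ((((continuous_flattenDeriv (hε k)).comp_continuousOn hcv).mul hcv').mul hch).add
      (((continuous_flatten (hε k)).comp_continuousOn hcv).mul hch')
  · exact integrableOn_of_continuousOn_closure hb
      ((hcv'.abs.mul hch.abs).add (hcv.abs.mul hch'.abs))
  · intro k
    filter_upwards [ae_restrict_mem hΩ.measurableSet] with x hx
    refine (abs_add_le _ _).trans ?_
    rw [abs_mul, abs_mul, abs_mul]
    exact add_le_add (mul_le_mul_of_nonneg_right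
        (mul_le_of_le_one_left (abs_nonneg _) (abs_flattenDeriv_le_one (hε k) _)) (abs_nonneg _))
      (mul_le_mul_of_nonneg_right (abs_flatten_le (hε k) (hpos x hx).le) (abs_nonneg _))
  · filter_upwards [ae_restrict_mem hΩ.measurableSet] with x hx
    have h1 := (tendsto_flattenDeriv (hpos x hx)).comp hε0
    have h2 := (tendsto_flatten (hpos x hx)).comp hε0
    simpa using ((h1.mul_const (fderiv ℝ v x e)).mul_const (h x)).add
      (h2.mul_const (fderiv ℝ h x e))

end GreenIdentity

section Laplacian

variable {n : ℕ} {Ω U : Set (EuclideanSpace ℝ (Fin n))} {u w : EuclideanSpace ℝ (Fin n) → ℝ}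

theorem contDiffOn_fderiv_apply (hU : IsOpen U) (hu : ContDiffOn ℝ 2 u U)
    (e : EuclideanSpace ℝ (Fin n)) : ContDiffOn ℝ 1 (fun x => fderiv ℝ u x e) U :=
  (hu.fderiv_of_isOpen hU (by norm_num)).clm_apply contDiffOn_const

theorem continuousOn_lapl (hU : IsOpen U) (hu : ContDiffOn ℝ 2 u U) : ContinuousOn (lapl u) U :=
  continuousOn_finsetSum _ fun _ _ =>
    ((contDiffOn_fderiv_apply hU hu _).continuousOn_fderiv_of_isOpen hU le_rfl).clm_apply
      continuousOn_const

theorem continuous_lapl (hu : ContDiff ℝ 2 u) : Continuous (lapl u) :=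
  continuousOn_univ.1 (continuousOn_lapl isOpen_univ hu.contDiffOn)

/-- Green's identity for functions vanishing on the boundary: one sided version. -/
theorem integral_sum_fderiv_mul_add_mul_lapl (hΩ : IsOpen Ω) (hb : Bornology.IsBounded Ω)
    (hU : IsOpen U) (hΩU : closure Ω ⊆ U) (hu : ContDiffOn ℝ 2 u U) (hw : ContDiffOn ℝ 2 w U)
    (hpos : ∀ x ∈ Ω, 0 < u x) (h0 : ∀ x ∈ frontier Ω, u x = 0) :
    ∫ x in Ω, ((∑ i, fderiv ℝ u x (EuclideanSpace.single i 1) *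
      fderiv ℝ w x (EuclideanSpace.single i 1)) + u x * lapl w x) = 0 := by
  have hu1 : ContDiffOn ℝ 1 u U := hu.of_le one_le_two
  have h : ∀ x, (∑ i, fderiv ℝ u x (EuclideanSpace.single i 1) *
      fderiv ℝ w x (EuclideanSpace.single i 1)) + u x * lapl w x =
      ∑ i : Fin n, (fderiv ℝ u x (EuclideanSpace.single i 1) *
        fderiv ℝ w x (EuclideanSpace.single i 1) + u x *
        fderiv ℝ (fun y => fderiv ℝ w y (EuclideanSpace.single i 1)) x
          (EuclideanSpace.single i 1)) := fun x => by
    rw [Finset.sum_add_distrib, lapl, Finset.mul_sum]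
  simp only [h]
  rw [integral_finsetSum]
  · exact Finset.sum_eq_zero fun i _ => integral_fderiv_mul_add_eq_zero hΩ hb hU hΩU hu1
      (contDiffOn_fderiv_apply hU hw _) hpos h0 _
  · intro i _
    refine integrableOn_of_continuousOn_closure hb (ContinuousOn.mono ?_ hΩU)
    exact ((contDiffOn_fderiv_apply hU hu _).continuousOn.mul
      (contDiffOn_fderiv_apply hU hw _).continuousOn).add (hu1.continuousOn.mul
      (((contDiffOn_fderiv_apply hU hw _).continuousOn_fderiv_of_isOpen hU le_rfl).clm_apply
        continuousOn_const))

/-- Green's identity for positive functions vanishing on the boundary. -/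
theorem integral_mul_lapl_comm (hΩ : IsOpen Ω) (hb : Bornology.IsBounded Ω)
    (hU : IsOpen U) (hΩU : closure Ω ⊆ U) (hu : ContDiffOn ℝ 2 u U) (hw : ContDiffOn ℝ 2 w U)
    (hupos : ∀ x ∈ Ω, 0 < u x) (hu0 : ∀ x ∈ frontier Ω, u x = 0)
    (hwpos : ∀ x ∈ Ω, 0 < w x) (hw0 : ∀ x ∈ frontier Ω, w x = 0) :
    ∫ x in Ω, u x * lapl w x = ∫ x in Ω, w x * lapl u x := by
  have h1 := integral_sum_fderiv_mul_add_mul_lapl hΩ hb hU hΩU hu hw hupos hu0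
  have h2 := integral_sum_fderiv_mul_add_mul_lapl hΩ hb hU hΩU hw hu hwpos hw0
  have hI : ∀ {p q : EuclideanSpace ℝ (Fin n) → ℝ}, ContDiffOn ℝ 2 p U → ContDiffOn ℝ 2 q U →
      IntegrableOn (fun x => ∑ i, fderiv ℝ p x (EuclideanSpace.single i 1) *
        fderiv ℝ q x (EuclideanSpace.single i 1)) Ω := fun hp hq =>
    integrableOn_of_continuousOn_closure hb (ContinuousOn.mono
      (continuousOn_finsetSum _ fun _ _ => (contDiffOn_fderiv_apply hU hp _).continuousOn.mul
        (contDiffOn_fderiv_apply hU hq _).continuousOn) hΩU)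
  have hL : ∀ {p q : EuclideanSpace ℝ (Fin n) → ℝ}, ContDiffOn ℝ 2 p U → ContDiffOn ℝ 2 q U →
      IntegrableOn (fun x => p x * lapl q x) Ω := fun hp hq =>
    integrableOn_of_continuousOn_closure hb
      ((hp.continuousOn.mul (continuousOn_lapl hU hq)).mono hΩU)
  rw [integral_add (hI hu hw) (hL hu hw)] at h1
  rw [integral_add (hI hw hu) (hL hw hu)] at h2
  simp only [mul_comm (fderiv ℝ w _ _)] at h2
  linarith

theorem lapl_mul (hu : ContDiff ℝ 2 u) (hw : ContDiff ℝ 2 w) (x : EuclideanSpace ℝ (Fin n)) :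
    lapl (fun y => u y * w y) x = u x * lapl w x + w x * lapl u x +
      2 * ∑ i, fderiv ℝ u x (EuclideanSpace.single i 1) *
        fderiv ℝ w x (EuclideanSpace.single i 1) := by
  have hd : ∀ {p : EuclideanSpace ℝ (Fin n) → ℝ}, ContDiff ℝ 2 p → ∀ y, DifferentiableAt ℝ p y :=
    fun hp y => hp.differentiable two_ne_zero y
  have hd' : ∀ {p : EuclideanSpace ℝ (Fin n) → ℝ}, ContDiff ℝ 2 p → ∀ e y,
      DifferentiableAt ℝ (fun z => fderiv ℝ p z e) y := fun hp e y =>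
    ((hp.fderiv_right (m := 1) (by norm_num)).clm_apply contDiff_const).differentiable
      one_ne_zero y
  simp only [lapl, Finset.mul_sum, ← Finset.sum_add_distrib]
  refine Finset.sum_congr rfl fun i _ => ?_
  set e : EuclideanSpace ℝ (Fin n) := EuclideanSpace.single i 1
  have h1 : (fun y => fderiv ℝ (fun y => u y * w y) y e) =
      fun y => u y * fderiv ℝ w y e + w y * fderiv ℝ u y e := funext fun y => by
    rw [fderiv_fun_mul (hd hu y) (hd hw y)]
    rfl
  rw [h1, fderiv_fun_add ((hd hu x).fun_mul (hd' hw e x)) ((hd hw x).fun_mul (hd' hu e x)),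
    fderiv_fun_mul (hd hu x) (hd' hw e x), fderiv_fun_mul (hd hw x) (hd' hu e x)]
  simp only [add_apply, smul_apply, smul_eq_mul]
  ring

theorem fderiv_exp_const_mul_apply (hu : ContDiff ℝ 2 u) (M : ℝ)
    (x e : EuclideanSpace ℝ (Fin n)) :
    fderiv ℝ (fun y => Real.exp (M * u y)) x e = M * (Real.exp (M * u x) * fderiv ℝ u x e) := by
  rw [((hu.differentiable two_ne_zero x).hasFDerivAt.const_mul M).exp.fderiv]
  simp only [smul_apply, smul_eq_mul]
  ring

theorem lapl_exp_const_mul (hu : ContDiff ℝ 2 u) (M : ℝ) (x : EuclideanSpace ℝ (Fin n)) :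
    lapl (fun y => Real.exp (M * u y)) x = Real.exp (M * u x) *
      (M ^ 2 * ∑ i, fderiv ℝ u x (EuclideanSpace.single i 1) ^ 2 + M * lapl u x) := by
  simp only [lapl, Finset.mul_sum, ← Finset.sum_add_distrib, fderiv_exp_const_mul_apply hu]
  refine Finset.sum_congr rfl fun i _ => ?_
  set e : EuclideanSpace ℝ (Fin n) := EuclideanSpace.single i 1
  have hE : ContDiff ℝ 2 fun y => Real.exp (M * u y) := (contDiff_const.mul hu).exp
  have h1 := hE.differentiable two_ne_zero x
  have h2 : DifferentiableAt ℝ (fun z => fderiv ℝ u z e) x :=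
    ((hu.fderiv_right (m := 1) (by norm_num)).clm_apply contDiff_const).differentiable
      one_ne_zero x
  rw [fderiv_const_mul (h1.fun_mul h2), fderiv_fun_mul h1 h2]
  simp only [add_apply, smul_apply, smul_eq_mul, fderiv_exp_const_mul_apply hu]
  ring

theorem fderiv_const_sub_coord_sq_apply (B : ℝ) (j : Fin n) (x e : EuclideanSpace ℝ (Fin n)) :
    fderiv ℝ (fun y : EuclideanSpace ℝ (Fin n) => B - y j ^ 2) x e = -(2 * x j * e j) := by
  have h := ((EuclideanSpace.proj j : EuclideanSpace ℝ (Fin n) →L[ℝ] ℝ).hasFDerivAt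
    (x := x)).pow 2 |>.const_sub B
  rw [HasFDerivAt.fderiv (f := fun y : EuclideanSpace ℝ (Fin n) => B - y j ^ 2) h]
  simp

theorem lapl_const_sub_coord_sq (B : ℝ) (j : Fin n) (x : EuclideanSpace ℝ (Fin n)) :
    lapl (fun y => B - y j ^ 2) x = -2 := by
  have h : ∀ i, fderiv ℝ (fun y : EuclideanSpace ℝ (Fin n) =>
      -(2 * y j * (EuclideanSpace.single i (1 : ℝ) : EuclideanSpace ℝ (Fin n)) j)) x
      (EuclideanSpace.single i 1) = if i = j then -2 else 0 := by
    intro i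
    have h := (((EuclideanSpace.proj j : EuclideanSpace ℝ (Fin n) →L[ℝ] ℝ).hasFDerivAt
      (x := x)).const_mul 2).mul_const
        ((EuclideanSpace.single i (1 : ℝ) : EuclideanSpace ℝ (Fin n)) j) |>.neg
    rw [HasFDerivAt.fderiv (f := fun y : EuclideanSpace ℝ (Fin n) =>
      -(2 * y j * (EuclideanSpace.single i (1 : ℝ) : EuclideanSpace ℝ (Fin n)) j)) h]
    rcases eq_or_ne i j with rfl | hij
    · simp
    · simp [hij, hij.symm]
  simp only [lapl, fderiv_const_sub_coord_sq_apply, h]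
  simp

end Laplacian

section Barriers

variable {n : ℕ} {Ω : Set (EuclideanSpace ℝ (Fin n))} {ρ : EuclideanSpace ℝ (Fin n) → ℝ}

theorem exists_pos_forall_abs_le (hb : Bornology.IsBounded Ω) {g : EuclideanSpace ℝ (Fin n) → ℝ}
    (hg : ContinuousOn g (closure Ω)) : ∃ K, 1 ≤ K ∧ ∀ x ∈ closure Ω, |g x| ≤ K := by
  obtain ⟨K, hK⟩ := hb.isCompact_closure.exists_bound_of_continuousOn hg
  exact ⟨max K 1, le_max_right _ _, fun x hx => (hK x hx).trans (le_max_left _ _)⟩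

/-- The squared Euclidean norm of the gradient. -/
def gradSq (ρ : EuclideanSpace ℝ (Fin n) → ℝ) (x : EuclideanSpace ℝ (Fin n)) : ℝ :=
  ∑ i, fderiv ℝ ρ x (EuclideanSpace.single i 1) ^ 2

theorem gradSq_nonneg (x : EuclideanSpace ℝ (Fin n)) : 0 ≤ gradSq ρ x :=
  Finset.sum_nonneg fun _ _ => sq_nonneg _

theorem gradSq_eq (x : EuclideanSpace ℝ (Fin n)) : gradSq ρ x = ‖gradient ρ x‖ ^ 2 := by
  rw [EuclideanSpace.norm_sq_eq, gradSq]
  refine Finset.sum_congr rfl fun i _ => ?_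
  rw [← InnerProductSpace.toDual_symm_apply (𝕜 := ℝ) (y := fderiv ℝ ρ x),
    EuclideanSpace.inner_single_right]
  simp [gradient]

theorem fderiv_gradient (x : EuclideanSpace ℝ (Fin n)) :
    fderiv ℝ ρ x (gradient ρ x) = gradSq ρ x := by
  rw [gradSq_eq, ← InnerProductSpace.toDual_symm_apply (𝕜 := ℝ) (y := fderiv ℝ ρ x)]
  exact real_inner_self_eq_norm_sq _

theorem continuous_fderiv_apply (hρ : ContDiff ℝ 2 ρ) (e : EuclideanSpace ℝ (Fin n)) :
    Continuous fun x => fderiv ℝ ρ x e :=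
  (hρ.continuous_fderiv two_ne_zero).clm_apply continuous_const

theorem continuous_gradSq (hρ : ContDiff ℝ 2 ρ) : Continuous (gradSq ρ) :=
  continuous_finsetSum _ fun _ _ => (continuous_fderiv_apply hρ _).pow 2

/-- A defining function has gradient bounded away from zero near the boundary. -/
theorem exists_gradSq_lower_bound (hΩ : IsOpen Ω) (hb : Bornology.IsBounded Ω) (hne : Ω.Nonempty)
    (hρ : ContDiff ℝ 2 ρ) (hneg : ∀ x ∈ Ω, ρ x < 0) (h0 : ∀ x ∈ frontier Ω, ρ x = 0)
    (hgrad : ∀ x ∈ frontier Ω, gradient ρ x ≠ 0) :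
    ∃ c > 0, ∀ x ∈ closure Ω, -ρ x ≤ c → c ≤ gradSq ρ x := by
  obtain ⟨y, hy, hmin⟩ := hb.isCompact_closure.exists_isMinOn hne.closure
    ((continuous_gradSq hρ).sub hρ.continuous).continuousOn
  have hpos : 0 < gradSq ρ y - ρ y := by
    by_cases hyΩ : y ∈ Ω
    · linarith [hneg y hyΩ, gradSq_nonneg (ρ := ρ) y]
    · have hyf : y ∈ frontier Ω := ⟨hy, by rwa [hΩ.interior_eq]⟩
      rw [h0 y hyf, gradSq_eq, sub_zero]
      exact pow_pos (norm_pos_iff.2 (hgrad y hyf)) 2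
  refine ⟨(gradSq ρ y - ρ y) / 2, half_pos hpos, fun x hx hxc => ?_⟩
  have := isMinOn_iff.1 hmin x hx
  rw [Pi.sub_apply, Pi.sub_apply] at this
  linarith

theorem exists_neg_le_mul_infDist (hb : Bornology.IsBounded Ω) (hρ : ContDiff ℝ 2 ρ)
    (h0 : ∀ x ∈ frontier Ω, ρ x = 0) (hfr : (frontier Ω).Nonempty) :
    ∃ K > 0, ∀ x ∈ Ω, -ρ x ≤ K * Metric.infDist x (frontier Ω) := by
  obtain ⟨R, hR⟩ := hb.closure.subset_closedBall 0
  obtain ⟨K, hK⟩ := (isCompact_closedBall (0 : EuclideanSpace ℝ (Fin n))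
    R).exists_bound_of_continuousOn (hρ.continuous_fderiv two_ne_zero).continuousOn
  refine ⟨max K 1, by positivity, fun x hx => ?_⟩
  obtain ⟨y, hy, hxy⟩ := (hb.isCompact_closure.of_isClosed_subset isClosed_frontier
    frontier_subset_closure).exists_infDist_eq_dist hfr x
  have h := (convex_closedBall (0 : EuclideanSpace ℝ (Fin n))
    R).norm_image_sub_le_of_norm_fderiv_le (fun z _ => hρ.differentiable two_ne_zero z) hK
    (hR (subset_closure hx)) (hR (frontier_subset_closure hy))
  rw [h0 y hy, zero_sub, norm_neg, ← dist_eq_norm, dist_comm, ← hxy] at h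
  calc -ρ x ≤ ‖ρ x‖ := neg_le_abs _
    _ ≤ K * Metric.infDist x (frontier Ω) := h
    _ ≤ _ := mul_le_mul_of_nonneg_right (le_max_left _ _) Metric.infDist_nonneg

theorem exists_infDist_le_mul_neg (hΩ : IsOpen Ω) (hb : Bornology.IsBounded Ω) (hne : Ω.Nonempty)
    (hρ : ContDiff ℝ 2 ρ) (hneg : ∀ x ∈ Ω, ρ x < 0) (hfr : frontier Ω = {x | ρ x = 0})
    (hgrad : ∀ x ∈ frontier Ω, gradient ρ x ≠ 0) :
    ∃ K > 0, ∀ x ∈ Ω, Metric.infDist x (frontier Ω) ≤ K * -ρ x := by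
  obtain ⟨c, hc, hcG⟩ := exists_gradSq_lower_bound hΩ hb hne hρ hneg
    (fun x hx => by rwa [hfr] at hx) hgrad
  obtain ⟨D, hD1, hD⟩ := exists_pos_forall_abs_le hb
    (Metric.continuous_infDist_pt (frontier Ω)).continuousOn
  obtain ⟨N, hN1, hN⟩ := exists_pos_forall_abs_le hb (g := fun x => ‖gradient ρ x‖)
    (by
      have : Continuous (gradient ρ) := (InnerProductSpace.toDual ℝ _).symm.continuous.comp
        (hρ.continuous_fderiv two_ne_zero)
      exact this.norm.continuousOn)
  simp only [abs_norm] at hN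
  have hN0 : 0 < N := by linarith
  obtain ⟨R, hR⟩ := hb.closure.subset_closedBall 0
  have huc := (isCompact_closedBall (0 : EuclideanSpace ℝ (Fin n))
    (R + 1)).uniformContinuousOn_of_continuous (hρ.continuous_fderiv two_ne_zero).continuousOn
  obtain ⟨r, hr, hruc⟩ := Metric.uniformContinuousOn_iff.1 huc (c / (2 * N)) (by positivity)
  set t : ℝ := min (r / 2) 1 / N with ht
  have ht0 : 0 < t := by positivity
  have htr : t * N < r := by
    rw [ht, div_mul_cancel₀ _ hN0.ne']
    exact (min_le_left _ _).trans_lt (by linarith)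
  have ht1 : t * N ≤ 1 := by
    rw [ht, div_mul_cancel₀ _ hN0.ne']
    exact min_le_right _ _
  have key : ∀ x ∈ Ω, -ρ x ≤ c → ∀ s, 0 ≤ s → s ≤ t →
      ρ x + s * (c / 2) ≤ ρ (x + s • gradient ρ x) := by
    intro x hx hxc s hs hst
    have hxc' := subset_closure hx
    have hG := hcG x hxc' hxc
    have hsN : ‖s • gradient ρ x‖ ≤ s * N := by
      rw [norm_smul, Real.norm_of_nonneg hs]
      exact mul_le_mul_of_nonneg_left (hN x hxc') hs
    have hsN' : s * N ≤ t * N := mul_le_mul_of_nonneg_right hst hN0.le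
    have hxR := mem_closedBall_zero_iff.1 (hR hxc')
    have hsub : ∀ z ∈ Metric.closedBall x (s * N), ‖fderiv ℝ ρ z - fderiv ℝ ρ x‖ ≤ c / (2 * N) := by
      intro z hz
      rw [← dist_eq_norm]
      rw [Metric.mem_closedBall] at hz
      refine (hruc z ?_ x ?_ (by linarith)).le
      · rw [mem_closedBall_zero_iff]
        have : ‖z‖ ≤ ‖z - x‖ + ‖x‖ := by simpa using norm_add_le (z - x) x
        rw [dist_eq_norm] at hz
        linarith
      · rw [mem_closedBall_zero_iff]
        linarith
    have h := (convex_closedBall x (s * N)).norm_image_sub_le_of_norm_fderiv_le' (𝕜 := ℝ)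
      (fun z _ => hρ.differentiable two_ne_zero z) hsub
      (Metric.mem_closedBall_self (by positivity))
      (y := x + s • gradient ρ x) (by rw [Metric.mem_closedBall, dist_eq_norm]; simpa using hsN)
    rw [add_sub_cancel_left, map_smul, fderiv_gradient, smul_eq_mul, Real.norm_eq_abs] at h
    have h1 := neg_le_of_abs_le h
    have h2 : c / (2 * N) * ‖s • gradient ρ x‖ ≤ s * (c / 2) := by
      calc c / (2 * N) * ‖s • gradient ρ x‖ ≤ c / (2 * N) * (s * N) :=
            mul_le_mul_of_nonneg_left hsN (by positivity)
        _ = s * (c / 2) := by field_simp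
    have h3 : s * c ≤ s * gradSq ρ x := mul_le_mul_of_nonneg_left hG hs
    linarith
  set m : ℝ := min c (t * (c / 2)) with hm
  have hm0 : 0 < m := by positivity
  refine ⟨max (D / m) (2 * N / c), by positivity, fun x hx => ?_⟩
  have hρx := hneg x hx
  by_cases hxm : m ≤ -ρ x
  · calc Metric.infDist x (frontier Ω) ≤ D := (le_abs_self _).trans (hD x (subset_closure hx))
      _ = D / m * m := by field_simp
      _ ≤ max (D / m) (2 * N / c) * -ρ x :=
        mul_le_mul (le_max_left _ _) hxm hm0.le (by positivity)
  · rw [not_le] at hxm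
    have hxc : -ρ x ≤ c := hxm.le.trans (min_le_left _ _)
    set s : ℝ := 2 * -ρ x / c with hs
    have hs0 : 0 ≤ s := by
      have : 0 < -ρ x := by linarith
      positivity
    have hst : s ≤ t := by
      rw [hs, div_le_iff₀ hc]
      linarith [hxm.le.trans (min_le_right _ _)]
    have hend := key x hx hxc s hs0 hst
    have hsc : s * (c / 2) = -ρ x := by rw [hs]; field_simp
    have hcont : ContinuousOn (fun a : ℝ => ρ (x + a • gradient ρ x)) (Set.Icc 0 s) :=
      (hρ.continuous.comp (by fun_prop)).continuousOn
    obtain ⟨a, ⟨ha0, has⟩, hρa⟩ := intermediate_value_Icc hs0 hcont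
      (show (0 : ℝ) ∈ Set.Icc _ _ from ⟨by simpa using hρx.le, by linarith⟩)
    calc Metric.infDist x (frontier Ω) ≤ dist x (x + a • gradient ρ x) :=
          Metric.infDist_le_dist_of_mem (by rw [hfr]; exact hρa)
      _ = a * ‖gradient ρ x‖ := by simp [norm_smul, abs_of_nonneg ha0]
      _ ≤ s * N := mul_le_mul has (hN x (subset_closure hx)) (norm_nonneg _) hs0
      _ = 2 * N / c * -ρ x := by rw [hs]; ring
      _ ≤ max (D / m) (2 * N / c) * -ρ x :=
        mul_le_mul_of_nonneg_right (le_max_right _ _) (by linarith)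

/-- A barrier comparable to the distance whose Laplacian is not too negative. -/
theorem exists_barrier_neg_lapl_le (hΩ : IsOpen Ω) (hb : Bornology.IsBounded Ω)
    (hne : Ω.Nonempty) (hρ : ContDiff ℝ 2 ρ) (hneg : ∀ x ∈ Ω, ρ x < 0)
    (h0 : ∀ x ∈ frontier Ω, ρ x = 0) (hgrad : ∀ x ∈ frontier Ω, gradient ρ x ≠ 0) :
    ∃ ξ : EuclideanSpace ℝ (Fin n) → ℝ, ContDiff ℝ 2 ξ ∧ (∀ x ∈ frontier Ω, ξ x = 0) ∧
      ∃ C > 0, ∀ x ∈ Ω, -ρ x ≤ ξ x ∧ -lapl ξ x ≤ C * -ρ x := by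
  obtain ⟨c, hc, hcG⟩ := exists_gradSq_lower_bound hΩ hb hne hρ hneg h0 hgrad
  obtain ⟨K, hK1, hK⟩ := exists_pos_forall_abs_le hb (continuous_lapl hρ).continuousOn
  set M : ℝ := 1 + K / c with hM
  have hM1 : 1 ≤ M := by
    have : 0 < K / c := by positivity
    linarith
  have hMc : K ≤ M * c := by
    have : M * c = c + K := by rw [hM]; field_simp
    linarith
  set ξ : EuclideanSpace ℝ (Fin n) → ℝ := fun x => Real.exp (-M * ρ x) - 1 with hξ
  have hξC : ContDiff ℝ 2 ξ := (contDiff_const.mul hρ).exp.sub contDiff_const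
  have hlapl : ∀ x, lapl ξ x = Real.exp (-M * ρ x) * ((-M) ^ 2 * gradSq ρ x + -M * lapl ρ x) := by
    intro x
    rw [gradSq, ← lapl_exp_const_mul hρ]
    simp only [lapl, hξ, fderiv_sub_const]
  obtain ⟨C, hC1, hC⟩ := exists_pos_forall_abs_le hb (continuous_lapl hξC).continuousOn
  refine ⟨ξ, hξC, fun x hx => by simp [hξ, h0 x hx], C / c, by positivity, fun x hx => ⟨?_, ?_⟩⟩
  · have h1 := Real.add_one_le_exp (-M * ρ x)
    have h2 := hneg x hx
    simp only [hξ]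
    nlinarith
  · have hρx := hneg x hx
    by_cases hxc : -ρ x ≤ c
    · have hG := hcG x (subset_closure hx) hxc
      have hL := (le_abs_self _).trans (hK x (subset_closure hx))
      have h1 : 0 ≤ lapl ξ x := by
        rw [hlapl]
        refine mul_nonneg (Real.exp_pos _).le ?_
        have : 0 ≤ M * (M * gradSq ρ x - lapl ρ x) :=
          mul_nonneg (by linarith) (by nlinarith)
        linarith
      have h2 : 0 ≤ C / c * -ρ x := mul_nonneg (by positivity) (by linarith)
      linarith
    · calc -lapl ξ x ≤ C := (neg_le_abs _).trans (hC x (subset_closure hx))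
        _ = C / c * c := by field_simp
        _ ≤ C / c * -ρ x := mul_le_mul_of_nonneg_left (not_le.1 hxc).le (by positivity)

/-- A strictly superharmonic barrier bounded by the distance. -/
theorem exists_barrier_one_le_neg_lapl (hn : 0 < n) (hΩ : IsOpen Ω) (hb : Bornology.IsBounded Ω)
    (hne : Ω.Nonempty) (hρ : ContDiff ℝ 2 ρ) (hneg : ∀ x ∈ Ω, ρ x < 0)
    (h0 : ∀ x ∈ frontier Ω, ρ x = 0) (hgrad : ∀ x ∈ frontier Ω, gradient ρ x ≠ 0) :
    ∃ ξ : EuclideanSpace ℝ (Fin n) → ℝ, ContDiff ℝ 2 ξ ∧ (∀ x ∈ frontier Ω, ξ x = 0) ∧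
      ∃ C > 0, ∀ x ∈ Ω, 0 < ξ x ∧ ξ x ≤ C * -ρ x ∧ 1 ≤ -lapl ξ x := by
  obtain ⟨c, hc, hcG⟩ := exists_gradSq_lower_bound hΩ hb hne hρ hneg h0 hgrad
  set j : Fin n := ⟨0, hn⟩
  obtain ⟨B, hB1, hB⟩ := exists_pos_forall_abs_le hb
    (g := fun x : EuclideanSpace ℝ (Fin n) => x j ^ 2) (by fun_prop)
  set b : EuclideanSpace ℝ (Fin n) → ℝ := fun x => (B + 1) - x j ^ 2 with hbdef
  have hbC : ContDiff ℝ 2 b := by fun_prop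
  have hb1 : ∀ x ∈ Ω, 1 ≤ b x := fun x hx => by
    have := (le_abs_self _).trans (hB x (subset_closure hx))
    simp only [hbdef]
    linarith
  have hbB : ∀ x, b x ≤ B + 1 := fun x => by simp only [hbdef]; nlinarith [sq_nonneg (x j)]
  set S : EuclideanSpace ℝ (Fin n) → ℝ := fun x => ∑ i, fderiv ℝ ρ x (EuclideanSpace.single i 1) *
    fderiv ℝ b x (EuclideanSpace.single i 1) with hS
  have hSc : Continuous S := continuous_finsetSum _ fun i _ =>
    (continuous_fderiv_apply hρ _).mul (continuous_fderiv_apply hbC _)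
  obtain ⟨K₁, hK₁1, hK₁⟩ := exists_pos_forall_abs_le hb hSc.continuousOn
  obtain ⟨K₂, hK₂1, hK₂⟩ := exists_pos_forall_abs_le hb (continuous_lapl hρ).continuousOn
  set Q : ℝ := (B + 1) * K₂ + 2 * K₁ with hQ
  have hQ0 : 0 < Q := by positivity
  set M : ℝ := 1 + (Q + 2) / c + 2 * (2 + Q) / c ^ 2 with hM
  have hM1 : 1 ≤ M := by
    have : 0 < (Q + 2) / c + 2 * (2 + Q) / c ^ 2 := by positivity
    linarith
  have hMc : Q + 2 ≤ M * c := by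
    have : M * c = c + (Q + 2) + 2 * (2 + Q) / c := by rw [hM]; field_simp
    have : 0 < 2 * (2 + Q) / c := by positivity
    linarith
  have hMc2 : 2 * (2 + Q) ≤ M * c ^ 2 := by
    have : M * c ^ 2 = c ^ 2 + (Q + 2) * c + 2 * (2 + Q) := by rw [hM]; field_simp
    have : 0 < c ^ 2 + (Q + 2) * c := by positivity
    linarith
  set a : EuclideanSpace ℝ (Fin n) → ℝ := fun x => 1 - Real.exp (M * ρ x) with ha
  have haC : ContDiff ℝ 2 a := contDiff_const.sub (contDiff_const.mul hρ).exp
  have hlapla : ∀ x, lapl a x = -(Real.exp (M * ρ x) * (M ^ 2 * gradSq ρ x + M * lapl ρ x)) := by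
    intro x
    rw [gradSq, ← lapl_exp_const_mul hρ]
    simp only [lapl, ha, fderiv_const_sub, neg_apply, fderiv_fun_neg, Finset.sum_neg_distrib]
  have hfa : ∀ x e, fderiv ℝ a x e = -(M * (Real.exp (M * ρ x) * fderiv ℝ ρ x e)) := by
    intro x e
    rw [← fderiv_exp_const_mul_apply hρ]
    simp only [ha, fderiv_const_sub, neg_apply]
  have hlapl : ∀ x, -lapl (fun y => a y * b y) x = 2 * (1 - Real.exp (M * ρ x)) +
      Real.exp (M * ρ x) * (M * (b x * (M * gradSq ρ x + lapl ρ x) + 2 * S x)) := by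
    intro x
    rw [lapl_mul haC hbC, lapl_const_sub_coord_sq, hlapla]
    have : ∑ i, fderiv ℝ a x (EuclideanSpace.single i 1) *
        fderiv ℝ b x (EuclideanSpace.single i 1) = -(M * Real.exp (M * ρ x)) * S x := by
      rw [hS, Finset.mul_sum]
      refine Finset.sum_congr rfl fun i _ => ?_
      rw [hfa]
      ring
    rw [this, ha]
    ring
  have hapos : ∀ x ∈ Ω, 0 < a x := fun x hx => by
    have : Real.exp (M * ρ x) < 1 := Real.exp_lt_one_iff.2 (by nlinarith [hneg x hx])
    simp only [ha]
    linarith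
  refine ⟨fun y => a y * b y, haC.mul hbC, fun x hx => by simp [ha, h0 x hx],
    M * (B + 1), by positivity, fun x hx => ⟨?_, ?_, ?_⟩⟩
  · exact mul_pos (hapos x hx) (by linarith [hb1 x hx])
  · have h1 : a x ≤ M * -ρ x := by
      have := Real.add_one_le_exp (M * ρ x)
      simp only [ha]
      linarith
    calc a x * b x ≤ (M * -ρ x) * (B + 1) :=
          mul_le_mul h1 (hbB x) (by linarith [hb1 x hx]) ((hapos x hx).le.trans h1)
      _ = M * (B + 1) * -ρ x := by ring
  · rw [hlapl]
    have hρx := hneg x hx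
    have hE0 := Real.exp_pos (M * ρ x)
    have hE1 : Real.exp (M * ρ x) < 1 := Real.exp_lt_one_iff.2 (by nlinarith)
    have hSx := neg_le_of_abs_le (hK₁ x (subset_closure hx))
    have hLx := neg_le_of_abs_le (hK₂ x (subset_closure hx))
    have hG0 := gradSq_nonneg (ρ := ρ) x
    have hbx := hb1 x hx
    have hbL : -((B + 1) * K₂) ≤ b x * lapl ρ x := by nlinarith [hbB x]
    have hbG : M * gradSq ρ x ≤ b x * (M * gradSq ρ x) :=
      le_mul_of_one_le_left (by positivity) hbx
    have hbr : M * gradSq ρ x - Q ≤ b x * (M * gradSq ρ x + lapl ρ x) + 2 * S x := by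
      rw [hQ, mul_add]
      linarith
    by_cases hxc : -ρ x ≤ c
    · have hG := hcG x (subset_closure hx) hxc
      have h1 : M * c ≤ M * gradSq ρ x := mul_le_mul_of_nonneg_left hG (by linarith)
      have h2 : 2 ≤ b x * (M * gradSq ρ x + lapl ρ x) + 2 * S x := by linarith
      have h3 := mul_le_mul_of_nonneg_left (h2.trans (le_mul_of_one_le_left (by linarith) hM1))
        hE0.le
      linarith
    · have hMρ : M * ρ x ≤ -(M * c) := by nlinarith [not_le.1 hxc]
      have hE : Real.exp (M * ρ x) * (2 + M * Q) ≤ 1 := by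
        have h1 : 2 + M * Q ≤ Real.exp (M * c) := by
          have := Real.quadratic_le_exp_of_nonneg (x := M * c) (by positivity)
          have h3 : M * (2 * (2 + Q)) ≤ M * (M * c ^ 2) :=
            mul_le_mul_of_nonneg_left hMc2 (by linarith)
          have h4 : 0 < M * c := by positivity
          nlinarith
        calc Real.exp (M * ρ x) * (2 + M * Q) ≤ Real.exp (-(M * c)) * Real.exp (M * c) :=
              mul_le_mul (Real.exp_le_exp.2 hMρ) h1 (by positivity) (Real.exp_pos _).le
          _ = 1 := by rw [← Real.exp_add, neg_add_cancel, Real.exp_zero]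
      have h2 : -(M * Q) ≤ M * (b x * (M * gradSq ρ x + lapl ρ x) + 2 * S x) := by
        have h3 : 0 ≤ M * gradSq ρ x := by positivity
        rw [← mul_neg]
        exact mul_le_mul_of_nonneg_left (by linarith) (by linarith)
      have h5 := mul_le_mul_of_nonneg_left h2 hE0.le
      linarith

end Barriers

/-- (Comparability of `‖u‖_{L¹}`, `‖u‖_{L¹_δ}` and
`‖f(u)‖_{L¹_δ}` for positive solutions with nonnegative nonlinearity.) -/
theorem comparability_of_norms
    (n : ℕ) (hn : 2 ≤ n)
    (Ω : Set (EuclideanSpace ℝ (Fin n))) (hΩ : IsSmoothBoundedDomain Ω) :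
    ∃ C : ℝ, 1 ≤ C ∧
      ∀ f : ℝ → ℝ, Continuous f → (∀ s : ℝ, 0 ≤ s → 0 ≤ f s) →
      ∀ u : EuclideanSpace ℝ (Fin n) → ℝ,
        IsClassicalSol Ω f u → (∀ x ∈ Ω, 0 < u x) →
        (∫ x in Ω, u x) ≤ C * (∫ x in Ω, u x * Metric.infDist x (frontier Ω)) ∧
        (∫ x in Ω, u x) ≤ C * (∫ x in Ω, f (u x) * Metric.infDist x (frontier Ω)) ∧
        (∫ x in Ω, u x * Metric.infDist x (frontier Ω)) ≤ C * (∫ x in Ω, u x) ∧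
        (∫ x in Ω, u x * Metric.infDist x (frontier Ω))
          ≤ C * (∫ x in Ω, f (u x) * Metric.infDist x (frontier Ω)) ∧
        (∫ x in Ω, f (u x) * Metric.infDist x (frontier Ω)) ≤ C * (∫ x in Ω, u x) ∧
        (∫ x in Ω, f (u x) * Metric.infDist x (frontier Ω))
          ≤ C * (∫ x in Ω, u x * Metric.infDist x (frontier Ω)) := by
  obtain ⟨hO, hb, hne, ρ, hρ', hΩρ, hfr, hgrad⟩ := hΩ
  have hρ : ContDiff ℝ 2 ρ := hρ'.of_le (by norm_cast)
  have hneg : ∀ x ∈ Ω, ρ x < 0 := fun x hx => by rwa [hΩρ] at hx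
  have h0 : ∀ x ∈ frontier Ω, ρ x = 0 := fun x hx => by rwa [hfr] at hx
  have hn0 : 0 < n := by omega
  have : Nonempty (Fin n) := ⟨⟨0, hn0⟩⟩
  have hfrne : (frontier Ω).Nonempty := by
    rw [Set.nonempty_iff_ne_empty, Ne, frontier_eq_empty_iff, not_or]
    refine ⟨hne.ne_empty, fun h => ?_⟩
    rw [h] at hb
    exact NormedSpace.unbounded_univ ℝ (EuclideanSpace ℝ (Fin n)) hb
  set δ : EuclideanSpace ℝ (Fin n) → ℝ := fun x => Metric.infDist x (frontier Ω)
  have hδc : Continuous δ := Metric.continuous_infDist_pt _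
  have hδ0 : ∀ x, 0 ≤ δ x := fun x => Metric.infDist_nonneg
  obtain ⟨k₁, hk₁, hρδ⟩ := exists_neg_le_mul_infDist hb hρ h0 hfrne
  obtain ⟨k₂, hk₂, hδρ⟩ := exists_infDist_le_mul_neg hO hb hne hρ hneg hfr hgrad
  obtain ⟨ξ, hξ, hξ0, c₁, hc₁, hξ1⟩ := exists_barrier_neg_lapl_le hO hb hne hρ hneg h0 hgrad
  obtain ⟨ζ, hζ, hζ0, c₂, hc₂, hζ1⟩ :=
    exists_barrier_one_le_neg_lapl hn0 hO hb hne hρ hneg h0 hgrad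
  obtain ⟨R, hR1, hR⟩ := exists_pos_forall_abs_le hb hδc.continuousOn
  set A : ℝ := k₂ * (c₁ * k₁)
  set B : ℝ := c₂ * k₁
  have hA : 0 < A := by positivity
  have hB : 0 < B := by positivity
  refine ⟨(1 + A) * (1 + B) * R, ?_, fun f hf hf0 u hu hupos => ?_⟩
  · nlinarith [mul_pos hA hB]
  obtain ⟨⟨U, hU, hΩU, huC⟩, hueq, hu0⟩ := hu
  have huc : ContinuousOn u (closure Ω) := huC.continuousOn.mono hΩU
  have hfuc : ContinuousOn (fun x => f (u x)) (closure Ω) := hf.comp_continuousOn huc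
  have hfu0 : ∀ x ∈ Ω, 0 ≤ f (u x) := fun x hx => hf0 _ (hupos x hx).le
  have hint : ∀ {g : EuclideanSpace ℝ (Fin n) → ℝ}, ContinuousOn g (closure Ω) →
      IntegrableOn g Ω := fun hg => integrableOn_of_continuousOn_closure hb hg
  have green : ∀ w : EuclideanSpace ℝ (Fin n) → ℝ, ContDiff ℝ 2 w → (∀ x ∈ frontier Ω, w x = 0) →
      (∀ x ∈ Ω, 0 < w x) → ∫ x in Ω, f (u x) * w x = ∫ x in Ω, u x * -lapl w x := by
    intro w hw hw0 hwpos
    have h := integral_mul_lapl_comm hO hb hU hΩU huC hw.contDiffOn hupos hu0 hwpos hw0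
    simp only [mul_neg, integral_neg]
    rw [h, ← integral_neg]
    refine setIntegral_congr_fun hO.measurableSet fun x hx => ?_
    have := hueq x hx
    rw [show f (u x) = -lapl u x by linarith]
    ring
  set J := ∫ x in Ω, u x
  set D := ∫ x in Ω, u x * δ x
  set F := ∫ x in Ω, f (u x) * δ x
  have hFD : F ≤ A * D := by
    calc F ≤ ∫ x in Ω, k₂ * (f (u x) * ξ x) := by
          refine setIntegral_mono_on (hint (hfuc.mul hδc.continuousOn))
            (hint (continuousOn_const.mul (hfuc.mul hξ.continuous.continuousOn)))
            hO.measurableSet fun x hx => ?_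
          have h1 : δ x ≤ k₂ * ξ x :=
            (hδρ x hx).trans (mul_le_mul_of_nonneg_left (hξ1 x hx).1 hk₂.le)
          nlinarith [mul_le_mul_of_nonneg_left h1 (hfu0 x hx)]
      _ = k₂ * ∫ x in Ω, u x * -lapl ξ x := by
          rw [integral_const_mul, green ξ hξ hξ0 fun x hx => by linarith [hneg x hx, (hξ1 x hx).1]]
      _ ≤ k₂ * ∫ x in Ω, (c₁ * k₁) * (u x * δ x) := by
          refine mul_le_mul_of_nonneg_left (setIntegral_mono_on
            (hint (huc.mul (continuous_lapl hξ).neg.continuousOn))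
            (hint (continuousOn_const.mul (huc.mul hδc.continuousOn)))
            hO.measurableSet fun x hx => ?_) hk₂.le
          have h1 : -lapl ξ x ≤ c₁ * (k₁ * δ x) :=
            (hξ1 x hx).2.trans (mul_le_mul_of_nonneg_left (hρδ x hx) hc₁.le)
          nlinarith [mul_le_mul_of_nonneg_left h1 (hupos x hx).le]
      _ = A * D := by rw [integral_const_mul, ← mul_assoc]
  have hJF : J ≤ B * F := by
    calc J ≤ ∫ x in Ω, u x * -lapl ζ x := by
          refine setIntegral_mono_on (hint huc)
            (hint (huc.mul (continuous_lapl hζ).neg.continuousOn)) hO.measurableSet fun x hx => ?_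
          exact le_mul_of_one_le_right (hupos x hx).le (hζ1 x hx).2.2
      _ = ∫ x in Ω, f (u x) * ζ x := (green ζ hζ hζ0 fun x hx => (hζ1 x hx).1).symm
      _ ≤ ∫ x in Ω, B * (f (u x) * δ x) := by
          refine setIntegral_mono_on (hint (hfuc.mul hζ.continuous.continuousOn))
            (hint (continuousOn_const.mul (hfuc.mul hδc.continuousOn)))
            hO.measurableSet fun x hx => ?_
          have h1 : ζ x ≤ c₂ * (k₁ * δ x) :=
            (hζ1 x hx).2.1.trans (mul_le_mul_of_nonneg_left (hρδ x hx) hc₂.le)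
          nlinarith [mul_le_mul_of_nonneg_left h1 (hfu0 x hx)]
      _ = B * F := integral_const_mul _ _
  have hDJ : D ≤ R * J := by
    calc D ≤ ∫ x in Ω, R * u x := by
          refine setIntegral_mono_on (hint (huc.mul hδc.continuousOn))
            (hint (continuousOn_const.mul huc)) hO.measurableSet fun x hx => ?_
          rw [mul_comm R]
          exact mul_le_mul_of_nonneg_left ((le_abs_self _).trans (hR x (subset_closure hx)))
            (hupos x hx).le
      _ = R * J := integral_const_mul _ _
  have hJ0 : 0 ≤ J := setIntegral_nonneg hO.measurableSet fun x hx => (hupos x hx).le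
  have hD0 : 0 ≤ D := setIntegral_nonneg hO.measurableSet fun x hx =>
    mul_nonneg (hupos x hx).le (hδ0 x)
  have hF0 : 0 ≤ F := setIntegral_nonneg hO.measurableSet fun x hx =>
    mul_nonneg (hfu0 x hx) (hδ0 x)
  have hAB : 0 < A * B := mul_pos hA hB
  have hle : ∀ {p q r : ℝ}, 0 ≤ q → r ≤ (1 + A) * (1 + B) * R → p ≤ r * q →
      p ≤ (1 + A) * (1 + B) * R * q := fun hq hr hp =>
    hp.trans (mul_le_mul_of_nonneg_right hr hq)
  refine ⟨hle (r := B * A) hD0 ?_ ?_, hle hF0 ?_ hJF, hle hJ0 ?_ hDJ, hle (r := R * B) hF0 ?_ ?_,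
    hle (r := A * R) hJ0 ?_ ?_, hle hD0 ?_ hFD⟩
  · nlinarith
  · rw [mul_assoc]
    exact hJF.trans (mul_le_mul_of_nonneg_left hFD hB.le)
  · nlinarith
  · nlinarith
  · nlinarith
  · rw [mul_assoc]
    exact hDJ.trans (mul_le_mul_of_nonneg_left hJF (by linarith))
  · nlinarith
  · rw [mul_assoc]
    exact hFD.trans (mul_le_mul_of_nonneg_left hDJ hA.le)
  · nlinarith
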